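/- Exchange relation for the Bethe vector: for every N ≥ 2, all nonzero complex w₁,…,w_N and every j = 1,…,N−1, Ř_{j,j+1}(w_j/w_{j+1}) |Ψ(w₁,…,w_j,w_{j+1},…,w_N)⟩ = [q w_j/w_{j+1}][q² w_j/w_{j+1}] |Ψ(w₁,…,w_{j+1},w_j,…,w_N)⟩, where the right-hand side is the Bethe vector evaluated at the tuple with w_j and w_{j+1} interchanged. -/

import Mathlib

open Matrix BigOperators Finset

noncomputable section

/-- `[z] = z - z⁻¹`. -/
def br (z : ℂ) : ℂ := z - z⁻¹

/-- R-matrix `R^{(1,2)}(z)` on ℂ²⊗ℂ³; basis `(ε, σ)` with ε ∈ {0=↑,1=↓}, σ ∈ {0=⇑,1=0,2=⇓}. -/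
def R12 (q c z : ℂ) : Matrix (Fin 2 × Fin 3) (Fin 2 × Fin 3) ℂ :=
  Matrix.of fun p p' =>
    if p = (0,0) ∧ p' = (0,0) then br (q^2*z)
    else if p = (0,1) ∧ p' = (0,1) then br (q*z)
    else if p = (0,2) ∧ p' = (0,2) then br z
    else if p = (1,0) ∧ p' = (1,0) then br z
    else if p = (1,1) ∧ p' = (1,1) then br (q*z)
    else if p = (1,2) ∧ p' = (1,2) then br (q^2*z)
    else if p = (0,1) ∧ p' = (1,0) then c
    else if p = (0,2) ∧ p' = (1,1) then c
    else if p = (1,0) ∧ p' = (0,1) then c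
    else if p = (1,1) ∧ p' = (0,2) then c
    else 0

/-- `R^{(1,2)}` acting on the auxiliary ℂ² and the j-th site of `(ℂ³)^{⊗N}`. -/
def R12at (q c z : ℂ) {N : ℕ} (j : Fin N) :
    Matrix (Fin 2 × (Fin N → Fin 3)) (Fin 2 × (Fin N → Fin 3)) ℂ :=
  Matrix.of fun p p' =>
    R12 q c z (p.1, p.2 j) (p'.1, p'.2 j) *
      if ∀ k, k ≠ j → p.2 k = p'.2 k then 1 else 0

/-- Monodromy matrix `𝒯_a(z) = R^{(1,2)}_{a,N}(q⁻¹z/w_N) ⋯ R^{(1,2)}_{a,1}(q⁻¹z/w₁)`. -/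
def monodromy (q c : ℂ) {N : ℕ} (w : Fin N → ℂ) (z : ℂ) :
    Matrix (Fin 2 × (Fin N → Fin 3)) (Fin 2 × (Fin N → Fin 3)) ℂ :=
  (((List.finRange N).reverse).map fun j => R12at q c (q⁻¹ * z / w j) j).prod

/-- The operator 𝒜(z): auxiliary block (↑,↑) of the monodromy matrix. -/
def Aop (q c : ℂ) {N : ℕ} (w : Fin N → ℂ) (z : ℂ) :
    Matrix (Fin N → Fin 3) (Fin N → Fin 3) ℂ :=
  Matrix.of fun σ τ => monodromy q c w z (0, σ) (0, τ)

/-- The operator ℬ(z): auxiliary block (↑,↓) of the monodromy matrix. -/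
def Bop (q c : ℂ) {N : ℕ} (w : Fin N → ℂ) (z : ℂ) :
    Matrix (Fin N → Fin 3) (Fin N → Fin 3) ℂ :=
  Matrix.of fun σ τ => monodromy q c w z (0, σ) (1, τ)

/-- The operator 𝒟(z): auxiliary block (↓,↓) of the monodromy matrix. -/
def Dop (q c : ℂ) {N : ℕ} (w : Fin N → ℂ) (z : ℂ) :
    Matrix (Fin N → Fin 3) (Fin N → Fin 3) ℂ :=
  Matrix.of fun σ τ => monodromy q c w z (1, σ) (1, τ)

/-- Bethe reference state `|∧⟩ = |⇑…⇑⟩`. -/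
def vac (N : ℕ) : (Fin N → Fin 3) → ℂ := fun σ => if σ = fun _ => 0 then 1 else 0

/-- Bethe vector `|Ψ(w₁,…,w_N)⟩ = ℬ(w₁)⋯ℬ(w_N)|∧⟩`. -/
def bethe (q c : ℂ) {N : ℕ} (w : Fin N → ℂ) : (Fin N → Fin 3) → ℂ :=
  (((List.finRange N).map fun j => Bop q c w (w j)).prod).mulVec (vac N)

/-- Nineteen-vertex R-matrix on ℂ³⊗ℂ³ (basis 0=⇑, 1=0, 2=⇓). -/
def R19 (q z : ℂ) : Matrix (Fin 3 × Fin 3) (Fin 3 × Fin 3) ℂ :=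
  Matrix.of fun p p' =>
    if p = (0,0) ∧ p' = (0,0) then br (q*z) * br (q^2*z)
    else if p = (2,2) ∧ p' = (2,2) then br (q*z) * br (q^2*z)
    else if p = (0,2) ∧ p' = (0,2) then br (q⁻¹*z) * br z
    else if p = (2,0) ∧ p' = (2,0) then br (q⁻¹*z) * br z
    else if p = (0,2) ∧ p' = (2,0) then br q * br (q^2)
    else if p = (2,0) ∧ p' = (0,2) then br q * br (q^2)
    else if p = (0,1) ∧ p' = (0,1) then br z * br (q*z)
    else if p = (1,0) ∧ p' = (1,0) then br z * br (q*z)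
    else if p = (1,2) ∧ p' = (1,2) then br z * br (q*z)
    else if p = (2,1) ∧ p' = (2,1) then br z * br (q*z)
    else if p = (0,1) ∧ p' = (1,0) then br (q^2) * br (q*z)
    else if p = (1,0) ∧ p' = (0,1) then br (q^2) * br (q*z)
    else if p = (1,2) ∧ p' = (2,1) then br (q^2) * br (q*z)
    else if p = (2,1) ∧ p' = (1,2) then br (q^2) * br (q*z)
    else if p = (1,1) ∧ p' = (0,2) then br (q^2) * br z
    else if p = (1,1) ∧ p' = (2,0) then br (q^2) * br z
    else if p = (0,2) ∧ p' = (1,1) then br (q^2) * br z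
    else if p = (2,0) ∧ p' = (1,1) then br (q^2) * br z
    else if p = (1,1) ∧ p' = (1,1) then br z * br (q*z) + br q * br (q^2)
    else 0

/-- The flip operator `P(u⊗v) = v⊗u` on ℂ³⊗ℂ³. -/
def Pflip : Matrix (Fin 3 × Fin 3) (Fin 3 × Fin 3) ℂ :=
  Matrix.of fun p p' => if p.1 = p'.2 ∧ p.2 = p'.1 then 1 else 0

/-- `Ř(z) = P R(z)`. -/
def Rcheck (q z : ℂ) : Matrix (Fin 3 × Fin 3) (Fin 3 × Fin 3) ℂ := Pflip * R19 q z

/-- A two-site operator acting on the factors j and j+1 of `(ℂ³)^{⊗N}`. -/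
def twoSite {N : ℕ} (M : Matrix (Fin 3 × Fin 3) (Fin 3 × Fin 3) ℂ)
    (j : Fin N) (h : (j : ℕ) + 1 < N) : Matrix (Fin N → Fin 3) (Fin N → Fin 3) ℂ :=
  Matrix.of fun σ τ =>
    M (σ j, σ ⟨(j : ℕ) + 1, h⟩) (τ j, τ ⟨(j : ℕ) + 1, h⟩) *
      if ∀ k, k ≠ j → k ≠ ⟨(j : ℕ) + 1, h⟩ → σ k = τ k then 1 else 0

open scoped Kronecker

/-- A one-site operator acting on the factor `k` of `(ℂ³)^{⊗N}`. -/
def siteOp {N : ℕ} (k : Fin N) (A : Matrix (Fin 3) (Fin 3) ℂ) :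
    Matrix (Fin N → Fin 3) (Fin N → Fin 3) ℂ :=
  Matrix.of fun σ τ => A (σ k) (τ k) * if ∀ i, i ≠ k → σ i = τ i then 1 else 0

theorem siteOp_mulVec {N : ℕ} (k : Fin N) (A : Matrix (Fin 3) (Fin 3) ℂ)
    (f : (Fin N → Fin 3) → ℂ) (σ : Fin N → Fin 3) :
    (siteOp k A *ᵥ f) σ = ∑ s, A (σ k) s * f (Function.update σ k s) := by
  rw [Matrix.mulVec, dotProduct]
  refine (Fintype.sum_of_injective (fun s => Function.update σ k s)
    (Function.update_injective σ k) _ _ ?_ ?_).symm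
  · intro τ hτ
    have : ¬ ∀ i, i ≠ k → σ i = τ i := fun h => hτ ⟨τ k, by
      ext i
      by_cases hi : i = k
      · subst hi; simp
      · simp [hi, h i hi]⟩
    simp [siteOp, this]
  · intro s
    have : ∀ i, i ≠ k → σ i = Function.update σ k s i := fun i hi => by simp [hi]
    simp only [siteOp, Matrix.of_apply, if_pos this, Function.update_self, mul_one]

theorem twoSite_mulVec {N : ℕ} (M : Matrix (Fin 3 × Fin 3) (Fin 3 × Fin 3) ℂ)
    (j : Fin N) (h : (j : ℕ) + 1 < N) (f : (Fin N → Fin 3) → ℂ) (σ : Fin N → Fin 3) :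
    (twoSite M j h *ᵥ f) σ = ∑ p : Fin 3 × Fin 3, M (σ j, σ ⟨(j : ℕ) + 1, h⟩) p *
      f (Function.update (Function.update σ j p.1) ⟨(j : ℕ) + 1, h⟩ p.2) := by
  have hne : j ≠ ⟨(j : ℕ) + 1, h⟩ := fun e => by simpa using congrArg Fin.val e
  have key : ∀ {M : Matrix (Fin 3 × Fin 3) (Fin 3 × Fin 3) ℂ} {j' : Fin N}, j ≠ j' →
    ∑ τ, (M (σ j, σ j') (τ j, τ j') * if ∀ k, k ≠ j → k ≠ j' → σ k = τ k then 1 else 0) * f τ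
      = ∑ p : Fin 3 × Fin 3, M (σ j, σ j') p *
      f (Function.update (Function.update σ j p.1) j' p.2) := by
    intro M j' hne
    refine (Fintype.sum_of_injective
      (fun p : Fin 3 × Fin 3 => Function.update (Function.update σ j p.1) j' p.2)
      ?_ _ _ ?_ ?_).symm
    · rintro ⟨a, b⟩ ⟨a', b'⟩ e
      have e1 := congrFun e j
      have e2 := congrFun e j'
      simp [hne] at e1 e2
      rw [e1, e2]
    · intro τ hτ
      have : ¬ ∀ i, i ≠ j → i ≠ j' → σ i = τ i := fun h => hτ ⟨(τ j, τ j'), by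
        ext i
        by_cases hi' : i = j'
        · subst hi'; simp
        · by_cases hi : i = j
          · subst hi; simp [hi']
          · simp [hi, hi', h i hi hi']⟩
      rw [if_neg this]; simp
    · rintro ⟨s, t⟩
      have : ∀ i, i ≠ j → i ≠ j' →
          σ i = Function.update (Function.update σ j s) j' t i := fun i hi hi' => by simp [hi, hi']
      simp only [if_pos this, mul_one]
      simp [hne]
  exact key hne

theorem siteOp_mul {N : ℕ} (k : Fin N) (A B : Matrix (Fin 3) (Fin 3) ℂ) :
    siteOp k A * siteOp k B = siteOp k (A * B) := by
  refine Matrix.ext_iff_mulVec.2 fun f => ?_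
  ext σ
  rw [← Matrix.mulVec_mulVec]
  simp only [siteOp_mulVec, Function.update_self, Function.update_idem, Matrix.mul_apply,
    Finset.mul_sum, Finset.sum_mul, mul_assoc]
  exact Finset.sum_comm

theorem siteOp_commute {N : ℕ} {k l : Fin N} (hkl : k ≠ l) (A B : Matrix (Fin 3) (Fin 3) ℂ) :
    Commute (siteOp k A) (siteOp l B) := by
  refine Matrix.ext_iff_mulVec.2 fun f => ?_
  ext σ
  rw [← Matrix.mulVec_mulVec, ← Matrix.mulVec_mulVec]
  simp only [siteOp_mulVec, Function.update_of_ne hkl, Function.update_of_ne hkl.symm,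
    Finset.mul_sum]
  rw [Finset.sum_comm]
  refine Finset.sum_congr rfl fun s _ => Finset.sum_congr rfl fun t _ => ?_
  rw [Function.update_comm hkl, mul_left_comm]

theorem twoSite_mul {N : ℕ} (A B : Matrix (Fin 3 × Fin 3) (Fin 3 × Fin 3) ℂ)
    (j : Fin N) (h : (j : ℕ) + 1 < N) :
    twoSite A j h * twoSite B j h = twoSite (A * B) j h := by
  have hne : j ≠ ⟨(j : ℕ) + 1, h⟩ := fun e => by simpa using congrArg Fin.val e
  refine Matrix.ext_iff_mulVec.2 fun f => ?_
  ext σ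
  rw [← Matrix.mulVec_mulVec]
  have hupd : ∀ (a b c d : Fin 3), Function.update (Function.update (Function.update
      (Function.update σ j a) ⟨(j : ℕ) + 1, h⟩ b) j c) ⟨(j : ℕ) + 1, h⟩ d =
      Function.update (Function.update σ j c) ⟨(j : ℕ) + 1, h⟩ d := fun a b c d => by
    ext i
    by_cases hi' : i = ⟨(j : ℕ) + 1, h⟩
    · subst hi'; simp
    · by_cases hi : i = j
      · subst hi; simp [hi']
      · simp [hi, hi']
  simp only [twoSite_mulVec, hupd, Function.update_self, Function.update_of_ne hne,
    Matrix.mul_apply, Finset.mul_sum, Finset.sum_mul, mul_assoc]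
  exact Finset.sum_comm

theorem twoSite_kronecker {N : ℕ} (A B : Matrix (Fin 3) (Fin 3) ℂ)
    (j : Fin N) (h : (j : ℕ) + 1 < N) :
    twoSite (A ⊗ₖ B) j h = siteOp ⟨(j : ℕ) + 1, h⟩ B * siteOp j A := by
  have hne : j ≠ ⟨(j : ℕ) + 1, h⟩ := fun e => by simpa using congrArg Fin.val e
  rw [(siteOp_commute hne.symm B A).eq]
  refine Matrix.ext_iff_mulVec.2 fun f => ?_
  ext σ
  rw [← Matrix.mulVec_mulVec]
  simp only [siteOp_mulVec, twoSite_mulVec, Fintype.sum_prod_type, Matrix.kroneckerMap_apply,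
    Function.update_of_ne hne.symm, Finset.mul_sum, mul_assoc]

theorem twoSite_sum {N : ℕ} {ι : Type*} (s : Finset ι)
    (A : ι → Matrix (Fin 3 × Fin 3) (Fin 3 × Fin 3) ℂ) (j : Fin N) (h : (j : ℕ) + 1 < N) :
    twoSite (∑ i ∈ s, A i) j h = ∑ i ∈ s, twoSite (A i) j h := by
  ext σ τ
  simp only [twoSite, Matrix.of_apply, Matrix.sum_apply, Finset.sum_mul]

theorem siteOp_smul_sum {N : ℕ} {ι : Type*} (s : Finset ι) (a : ι → ℂ)
    (A : ι → Matrix (Fin 3) (Fin 3) ℂ) (k : Fin N) :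
    siteOp k (∑ i ∈ s, a i • A i) = ∑ i ∈ s, a i • siteOp k (A i) := by
  ext σ τ
  simp only [siteOp, Matrix.of_apply, Matrix.sum_apply, Finset.sum_mul, Matrix.smul_apply,
    smul_eq_mul, mul_assoc]

theorem twoSite_commute_siteOp {N : ℕ} (M : Matrix (Fin 3 × Fin 3) (Fin 3 × Fin 3) ℂ)
    (A : Matrix (Fin 3) (Fin 3) ℂ) {j k : Fin N} (h : (j : ℕ) + 1 < N) (hk : k ≠ j)
    (hk' : k ≠ ⟨(j : ℕ) + 1, h⟩) : Commute (twoSite M j h) (siteOp k A) := by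
  refine Matrix.ext_iff_mulVec.2 fun f => ?_
  ext σ
  rw [← Matrix.mulVec_mulVec, ← Matrix.mulVec_mulVec]
  simp only [siteOp_mulVec, twoSite_mulVec, Function.update_of_ne hk, Function.update_of_ne hk',
    Function.update_of_ne hk.symm, Function.update_of_ne hk'.symm, Finset.mul_sum]
  rw [Finset.sum_comm]
  refine Finset.sum_congr rfl fun s _ => Finset.sum_congr rfl fun t _ => ?_
  rw [Function.update_comm hk'.symm, Function.update_comm hk.symm, mul_left_comm]

/-- The block of `R^{(1,2)}(z)` between the auxiliary states `α` and `β`. -/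
def laxBlock (q c z : ℂ) (α β : Fin 2) : Matrix (Fin 3) (Fin 3) ℂ :=
  Matrix.of fun s t => R12 q c z (α, s) (β, t)

/-- The six-vertex R-matrix on ℂ²⊗ℂ². -/
def R11 (q z : ℂ) : Matrix (Fin 2 × Fin 2) (Fin 2 × Fin 2) ℂ :=
  Matrix.of fun p p' =>
    if p = p' then (if p.1 = p.2 then br (q * z) else br z)
    else if p.1 = p'.2 ∧ p.2 = p'.1 then br q else 0

theorem laxBlock_00 (q c z : ℂ) :
    laxBlock q c z 0 0 = !![br (q^2*z), 0, 0; 0, br (q*z), 0; 0, 0, br z] := by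
  ext s t; fin_cases s <;> fin_cases t <;> simp [laxBlock, R12]

theorem laxBlock_01 (q c z : ℂ) :
    laxBlock q c z 0 1 = !![0, 0, 0; c, 0, 0; 0, c, 0] := by
  ext s t; fin_cases s <;> fin_cases t <;> simp [laxBlock, R12]

theorem laxBlock_10 (q c z : ℂ) :
    laxBlock q c z 1 0 = !![0, c, 0; 0, 0, c; 0, 0, 0] := by
  ext s t; fin_cases s <;> fin_cases t <;> simp [laxBlock, R12]

theorem laxBlock_11 (q c z : ℂ) :
    laxBlock q c z 1 1 = !![br z, 0, 0; 0, br (q*z), 0; 0, 0, br (q^2*z)] := by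
  ext s t; fin_cases s <;> fin_cases t <;> simp [laxBlock, R12]

theorem sum_R11_smul {V : Type*} [AddCommGroup V] [Module ℂ V] (q x : ℂ)
    (p : Fin 2 × Fin 2) (f : Fin 2 × Fin 2 → V) :
    ∑ r, R11 q x p r • f r =
      if p.1 = p.2 then br (q * x) • f p else br x • f p + br q • f (p.2, p.1) := by
  obtain ⟨α, γ⟩ := p
  fin_cases α <;> fin_cases γ <;> simp [Fintype.sum_prod_type, R11, add_comm]

theorem R11_comm (q x : ℂ) (p r : Fin 2 × Fin 2) : R11 q x p r = R11 q x r p := by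
  obtain ⟨α, γ⟩ := p
  obtain ⟨β, δ⟩ := r
  fin_cases α <;> fin_cases γ <;> fin_cases β <;> fin_cases δ <;> simp [R11]

set_option maxHeartbeats 8000000 in
theorem R11_laxBlock (q c x b : ℂ) (hq : q ≠ 0) (hx : x ≠ 0) (hb : b ≠ 0)
    (hc : c^2 = br q * br (q^2)) (p p' : Fin 2 × Fin 2) :
    ∑ r, R11 q x p r • (laxBlock q c (b * x) r.1 p'.1 * laxBlock q c b r.2 p'.2) =
      ∑ r, R11 q x r p' • (laxBlock q c b p.2 r.2 * laxBlock q c (b * x) p.1 r.1) := by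
  obtain ⟨α, γ⟩ := p
  obtain ⟨β, δ⟩ := p'
  have h1 : q * q⁻¹ = 1 := mul_inv_cancel₀ hq
  have h2 : x * x⁻¹ = 1 := mul_inv_cancel₀ hx
  have h3 : b * b⁻¹ = 1 := mul_inv_cancel₀ hb
  simp only [br, ← inv_pow] at hc
  simp only [R11_comm q x _ (β, δ), sum_R11_smul]
  generalize hq' : q⁻¹ = q' at *
  generalize hx' : x⁻¹ = x' at *
  generalize hb' : b⁻¹ = b' at *
  ext s t
  fin_cases α <;> fin_cases γ <;> fin_cases β <;> fin_cases δ <;>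
  simp only [Fin.zero_eta, Fin.mk_one, laxBlock_00, laxBlock_01, laxBlock_10, laxBlock_11] <;>
  fin_cases s <;> fin_cases t <;>
    simp <;>
    simp only [br, mul_inv, ← inv_pow, hq', hx', hb'] <;>
    clear hq' hx' hb' hq hx hb <;> grind

theorem Rcheck_apply (q z : ℂ) (s t : Fin 3) (p : Fin 3 × Fin 3) :
    Rcheck q z (s, t) p = R19 q z (t, s) p := by
  rw [Rcheck, Matrix.mul_apply, Finset.sum_eq_single (t, s)]
  · simp [Pflip]
  · rintro ⟨a, b⟩ - hne
    have : ¬ (s = b ∧ t = a) := fun h => hne (by rw [h.1, h.2])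
    simp [Pflip, this]
  · simp

theorem sum_Rcheck_mul (q x : ℂ) (s t : Fin 3) (f : Fin 3 → Fin 3 → ℂ) :
    ∑ a, ∑ b, Rcheck q x (s, t) (a, b) * f a b =
      ![![br (q*x) * br (q^2*x) * f 0 0,
          br x * br (q*x) * f 1 0 + br (q^2) * br (q*x) * f 0 1,
          br (q⁻¹*x) * br x * f 2 0 + br q * br (q^2) * f 0 2 + br (q^2) * br x * f 1 1],
        ![br x * br (q*x) * f 0 1 + br (q^2) * br (q*x) * f 1 0,
          (br x * br (q*x) + br q * br (q^2)) * f 1 1 + br (q^2) * br x * (f 0 2 + f 2 0),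
          br x * br (q*x) * f 2 1 + br (q^2) * br (q*x) * f 1 2],
        ![br (q⁻¹*x) * br x * f 0 2 + br q * br (q^2) * f 2 0 + br (q^2) * br x * f 1 1,
          br x * br (q*x) * f 1 2 + br (q^2) * br (q*x) * f 2 1,
          br (q*x) * br (q^2*x) * f 2 2]] s t := by
  simp only [Fin.sum_univ_three, Rcheck_apply]
  fin_cases s <;> fin_cases t <;> simp [R19] <;> ring

theorem Rcheck_comm (q x : ℂ) (p r : Fin 3 × Fin 3) : Rcheck q x p r = Rcheck q x r p := by
  obtain ⟨s, t⟩ := p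
  obtain ⟨s', t'⟩ := r
  simp only [Rcheck_apply]
  fin_cases s <;> fin_cases t <;> fin_cases s' <;> fin_cases t' <;> simp [R19]

set_option maxHeartbeats 20000000 in
theorem Rcheck_laxBlock (q c x a : ℂ) (hq : q ≠ 0) (hx : x ≠ 0) (ha : a ≠ 0)
    (hc : c^2 = br q * br (q^2)) (α γ : Fin 2) :
    Rcheck q x * ∑ β, laxBlock q c a β γ ⊗ₖ laxBlock q c (a * x) α β =
      (∑ β, laxBlock q c (a * x) β γ ⊗ₖ laxBlock q c a α β) * Rcheck q x := by
  have h1 : q * q⁻¹ = 1 := mul_inv_cancel₀ hq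
  have h2 : x * x⁻¹ = 1 := mul_inv_cancel₀ hx
  have h3 : a * a⁻¹ = 1 := mul_inv_cancel₀ ha
  simp only [br, ← inv_pow] at hc
  ext ⟨s, t⟩ ⟨s', t'⟩
  simp only [Matrix.mul_apply, Fintype.sum_prod_type]
  simp only [Rcheck_comm q x _ (s', t'), mul_comm _ (Rcheck q x _ _)]
  simp only [sum_Rcheck_mul, Matrix.add_apply, Fin.sum_univ_two, Matrix.kroneckerMap_apply]
  generalize hq' : q⁻¹ = q' at *
  generalize hx' : x⁻¹ = x' at *
  generalize ha' : a⁻¹ = a' at *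
  have h5 : q'⁻¹ = q := by rw [← hq', inv_inv]
  fin_cases α <;> fin_cases γ <;>
  simp only [Fin.zero_eta, Fin.mk_one, laxBlock_00, laxBlock_01, laxBlock_10, laxBlock_11] <;>
  fin_cases s <;> fin_cases t <;> fin_cases s' <;> fin_cases t' <;>
    simp <;>
    simp only [br, mul_inv, ← inv_pow, hq', hx', ha', h5] <;>
    clear h5 hq' hx' ha' hq hx ha <;> grind

/-- The matrix of operators `R^{(1,2)}_{a,k}(z)`, indexed by the states of the auxiliary space. -/
def lax (q c : ℂ) {N : ℕ} (k : Fin N) (z : ℂ) :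
    Matrix (Fin 2) (Fin 2) (Matrix (Fin N → Fin 3) (Fin N → Fin 3) ℂ) :=
  Matrix.of fun α β => siteOp k (laxBlock q c z α β)

/-- The monodromy matrix of the sites in `l`, as a matrix of operators. -/
def laxProd (q c : ℂ) {N : ℕ} (w : Fin N → ℂ) (l : List (Fin N)) (z : ℂ) :
    Matrix (Fin 2) (Fin 2) (Matrix (Fin N → Fin 3) (Fin N → Fin 3) ℂ) :=
  (l.map fun k => lax q c k (q⁻¹ * z / w k)).prod

theorem Bop_eq_laxProd (q c : ℂ) {N : ℕ} (w : Fin N → ℂ) (z : ℂ) :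
    Bop q c w z = laxProd q c w (List.finRange N).reverse z 0 1 := by
  have key : monodromy q c w z =
      Matrix.compRingEquiv (Fin 2) (Fin N → Fin 3) ℂ
        (laxProd q c w (List.finRange N).reverse z) := by
    rw [laxProd, map_list_prod, List.map_map]
    rfl
  ext σ τ
  rw [Bop, Matrix.of_apply, key]
  rfl

/-- The relation `R_{ab} S_a S'_b = S'_b S_a R_{ab}` of matrices of operators. -/
def RTT {A : Type*} [Ring A] [Algebra ℂ A] (r : Matrix (Fin 2 × Fin 2) (Fin 2 × Fin 2) ℂ)
    (S S' : Matrix (Fin 2) (Fin 2) A) : Prop :=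
  ∀ p p' : Fin 2 × Fin 2, ∑ s, r p s • (S s.1 p'.1 * S' s.2 p'.2) =
    ∑ s, r s p' • (S' p.2 s.2 * S p.1 s.1)

theorem RTT.one {A : Type*} [Ring A] [Algebra ℂ A]
    (r : Matrix (Fin 2 × Fin 2) (Fin 2 × Fin 2) ℂ) :
    RTT r (1 : Matrix (Fin 2) (Fin 2) A) 1 := by
  rintro ⟨α, γ⟩ ⟨β, δ⟩
  simp [Fintype.sum_prod_type, Matrix.one_apply]

theorem RTT.mul {A : Type*} [Ring A] [Algebra ℂ A]
    {r : Matrix (Fin 2 × Fin 2) (Fin 2 × Fin 2) ℂ} {S S' T T' : Matrix (Fin 2) (Fin 2) A}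
    (hS : RTT r S S') (hT : RTT r T T') (h : ∀ α β γ δ, Commute (T α β) (S' γ δ))
    (h' : ∀ α β γ δ, Commute (S α β) (T' γ δ)) : RTT r (S * T) (S' * T') := by
  intro p p'
  calc ∑ s, r p s • ((S * T) s.1 p'.1 * (S' * T') s.2 p'.2)
      = ∑ m : Fin 2 × Fin 2, (∑ s, r p s • (S s.1 m.1 * S' s.2 m.2)) *
          (T m.1 p'.1 * T' m.2 p'.2) := by
        simp only [Finset.sum_mul]
        rw [Finset.sum_comm]
        refine Finset.sum_congr rfl fun s _ => ?_
        rw [Matrix.mul_apply, Matrix.mul_apply, Finset.sum_mul_sum, Finset.smul_sum,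
          Fintype.sum_prod_type]
        refine Finset.sum_congr rfl fun m _ => ?_
        rw [Finset.smul_sum]
        refine Finset.sum_congr rfl fun n _ => ?_
        rw [smul_mul_assoc, (h m p'.1 s.2 n).mul_mul_mul_comm]
    _ = ∑ s : Fin 2 × Fin 2, (S' p.2 s.2 * S p.1 s.1) *
          ∑ m, r s m • (T m.1 p'.1 * T' m.2 p'.2) := by
        simp only [hS p _, Finset.sum_mul, Finset.mul_sum]
        rw [Finset.sum_comm]
        simp only [smul_mul_assoc, mul_smul_comm]
    _ = ∑ m, r m p' • ((S' * T') p.2 m.2 * (S * T) p.1 m.1) := by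
        simp only [hT _ p', Finset.mul_sum]
        rw [Finset.sum_comm]
        refine Finset.sum_congr rfl fun m _ => ?_
        rw [Matrix.mul_apply, Matrix.mul_apply, Finset.sum_mul_sum, Finset.smul_sum,
          Fintype.sum_prod_type, Finset.sum_comm]
        refine Finset.sum_congr rfl fun s _ => ?_
        rw [Finset.smul_sum]
        refine Finset.sum_congr rfl fun t _ => ?_
        rw [mul_smul_comm, (h' p.1 t s m.2).mul_mul_mul_comm]

theorem lax_commute_laxProd (q c : ℂ) {N : ℕ} (w : Fin N → ℂ) {l : List (Fin N)} {k : Fin N}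
    (hk : k ∉ l) (u z : ℂ) (α β γ δ : Fin 2) :
    Commute (lax q c k u α β) (laxProd q c w l z γ δ) := by
  induction l generalizing γ δ with
  | nil =>
    simp only [laxProd, List.map_nil, List.prod_nil, Matrix.one_apply]
    split_ifs
    · exact Commute.one_right _
    · exact Commute.zero_right _
  | cons i l ih =>
    rw [List.mem_cons, not_or] at hk
    have : laxProd q c w (i :: l) z = lax q c i (q⁻¹ * z / w i) * laxProd q c w l z := by
      simp [laxProd]
    rw [this, Matrix.mul_apply]
    exact Commute.sum_right _ _ _ fun m _ =>
      (siteOp_commute hk.1 _ _).mul_right (ih hk.2 m δ)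

theorem laxProd_RTT (q c : ℂ) (hq : q ≠ 0) (hc : c^2 = br q * br (q^2)) {N : ℕ}
    (w : Fin N → ℂ) (hw : ∀ j, w j ≠ 0) {z z' : ℂ} (hz : z ≠ 0) (hz' : z' ≠ 0)
    {l : List (Fin N)} (hl : l.Nodup) :
    RTT (R11 q (z / z')) (laxProd q c w l z) (laxProd q c w l z') := by
  induction l with
  | nil => exact RTT.one _
  | cons i l ih =>
    rw [List.nodup_cons] at hl
    have hcons : ∀ z, laxProd q c w (i :: l) z =
        lax q c i (q⁻¹ * z / w i) * laxProd q c w l z := fun z => by simp [laxProd]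
    rw [hcons, hcons]
    refine RTT.mul (fun p p' => ?_) (ih hl.2)
      (fun _ _ _ _ => (lax_commute_laxProd q c w hl.1 _ _ _ _ _ _).symm)
      (fun _ _ _ _ => lax_commute_laxProd q c w hl.1 _ _ _ _ _ _)
    have hb : q⁻¹ * z' / w i ≠ 0 := div_ne_zero (mul_ne_zero (inv_ne_zero hq) hz') (hw i)
    have he : q⁻¹ * z / w i = q⁻¹ * z' / w i * (z / z') := by
      field_simp
    have := congrArg (siteOp i) (R11_laxBlock q c (z / z') _ hq (div_ne_zero hz hz') hb hc p p')
    rw [siteOp_smul_sum, siteOp_smul_sum] at this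
    simpa only [lax, Matrix.of_apply, siteOp_mul, he] using this

theorem Bop_commute (q c : ℂ) (hq : q ≠ 0) (hc : c^2 = br q * br (q^2)) {N : ℕ}
    (w : Fin N → ℂ) (hw : ∀ j, w j ≠ 0) {z z' : ℂ} (hz : z ≠ 0) (hz' : z' ≠ 0)
    (hzz' : br (q * (z / z')) ≠ 0) : Commute (Bop q c w z) (Bop q c w z') := by
  have key := laxProd_RTT q c hq hc w hw hz hz'
    (List.nodup_reverse.2 (List.nodup_finRange N)) (0, 0) (1, 1)
  simp only [R11_comm q _ _ (1, 1), sum_R11_smul, if_true, ← Bop_eq_laxProd] at key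
  exact smul_right_injective _ hzz' key

theorem finRange_eq_append {N : ℕ} (j : Fin N) (h : (j : ℕ) + 1 < N) :
    ∃ l₁ l₂ : List (Fin N), List.finRange N = l₁ ++ j :: ⟨(j : ℕ) + 1, h⟩ :: l₂ ∧
      (∀ k ∈ l₁, k ≠ j ∧ k ≠ ⟨(j : ℕ) + 1, h⟩) ∧ ∀ k ∈ l₂, k ≠ j ∧ k ≠ ⟨(j : ℕ) + 1, h⟩ := by
  have hlen : (List.finRange N).length = N := List.length_finRange
  have heq : List.finRange N = (List.finRange N).take j ++
      j :: ⟨(j : ℕ) + 1, h⟩ :: (List.finRange N).drop (j + 2) := by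
    conv_lhs => rw [← List.take_append_drop j (List.finRange N)]
    rw [List.drop_eq_getElem_cons (by rw [hlen]; exact j.2),
      List.drop_eq_getElem_cons (by rw [hlen]; exact h)]
    simp
  refine ⟨_, _, heq, ?_, ?_⟩ <;>
  · have hnd := List.nodup_finRange N
    rw [heq, List.nodup_append] at hnd
    obtain ⟨-, h2, h3⟩ := hnd
    simp only [List.nodup_cons, List.mem_cons, not_or] at h2
    intro k hk
    grind

theorem diagonal_commute_lax (q c : ℂ) {N : ℕ} (M : Matrix (Fin 3 × Fin 3) (Fin 3 × Fin 3) ℂ)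
    {j k : Fin N} (h : (j : ℕ) + 1 < N) (hk : k ≠ j) (hk' : k ≠ ⟨(j : ℕ) + 1, h⟩) (z : ℂ) :
    Commute (Matrix.diagonal fun _ : Fin 2 => twoSite M j h) (lax q c k z) := by
  ext1 α β
  rw [Matrix.diagonal_mul, Matrix.mul_diagonal]
  exact twoSite_commute_siteOp M _ h hk hk'

theorem diagonal_mul_laxProd (q c : ℂ) {N : ℕ} (w w' : Fin N → ℂ)
    (M : Matrix (Fin 3 × Fin 3) (Fin 3 × Fin 3) ℂ)
    {j : Fin N} (h : (j : ℕ) + 1 < N) {l : List (Fin N)}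
    (hl : ∀ k ∈ l, k ≠ j ∧ k ≠ ⟨(j : ℕ) + 1, h⟩) (hw : ∀ k ∈ l, w' k = w k) (z : ℂ) :
    Matrix.diagonal (fun _ : Fin 2 => twoSite M j h) * laxProd q c w l z =
      laxProd q c w' l z * Matrix.diagonal (fun _ : Fin 2 => twoSite M j h) := by
  induction l with
  | nil => simp [laxProd]
  | cons i l ih =>
    have hcons : ∀ w, laxProd q c w (i :: l) z =
        lax q c i (q⁻¹ * z / w i) * laxProd q c w l z := fun w => by simp [laxProd]
    rw [hcons, hcons, ← mul_assoc, (diagonal_commute_lax q c M h (hl i (by simp)).1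
      (hl i (by simp)).2 _).eq, mul_assoc, ih (fun k hk => hl k (by simp [hk]))
      (fun k hk => hw k (by simp [hk])), mul_assoc, hw i (by simp)]

theorem diagonal_mul_lax_mul_lax (q c x a : ℂ) (hq : q ≠ 0) (hx : x ≠ 0) (ha : a ≠ 0)
    (hc : c^2 = br q * br (q^2)) {N : ℕ} (j : Fin N) (h : (j : ℕ) + 1 < N) :
    Matrix.diagonal (fun _ : Fin 2 => twoSite (Rcheck q x) j h) *
        (lax q c ⟨(j : ℕ) + 1, h⟩ (a * x) * lax q c j a) =
      lax q c ⟨(j : ℕ) + 1, h⟩ a * lax q c j (a * x) *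
        Matrix.diagonal (fun _ : Fin 2 => twoSite (Rcheck q x) j h) := by
  ext1 α γ
  rw [Matrix.diagonal_mul, Matrix.mul_diagonal, Matrix.mul_apply, Matrix.mul_apply]
  simp only [lax, Matrix.of_apply, ← twoSite_kronecker]
  rw [← twoSite_sum, ← twoSite_sum, twoSite_mul, twoSite_mul,
    Rcheck_laxBlock q c x a hq hx ha hc]

theorem twoSite_mul_Bop (q c : ℂ) (hq : q ≠ 0) (hc : c^2 = br q * br (q^2)) {N : ℕ}
    (w : Fin N → ℂ) (hw : ∀ j, w j ≠ 0) (j : Fin N) (h : (j : ℕ) + 1 < N) {z : ℂ} (hz : z ≠ 0) :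
    twoSite (Rcheck q (w j / w ⟨(j : ℕ) + 1, h⟩)) j h * Bop q c w z =
      Bop q c (w ∘ Equiv.swap j ⟨(j : ℕ) + 1, h⟩) z *
        twoSite (Rcheck q (w j / w ⟨(j : ℕ) + 1, h⟩)) j h := by
  obtain ⟨l₁, l₂, hl, h₁, h₂⟩ := finRange_eq_append j h
  set j' : Fin N := ⟨(j : ℕ) + 1, h⟩ with hj'
  set w' := w ∘ Equiv.swap j j' with hw'
  have hswap : ∀ k, k ≠ j ∧ k ≠ j' → w' k = w k := fun k hk => by
    simp [hw', Equiv.swap_apply_of_ne_of_ne hk.1 hk.2]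
  have hwj : w' j = w j' := by simp [hw']
  have hwj' : w' j' = w j := by simp [hw']
  have hsplit : ∀ v : Fin N → ℂ, laxProd q c v (List.finRange N).reverse z =
      laxProd q c v l₂.reverse z *
        ((lax q c j' (q⁻¹ * z / v j') * lax q c j (q⁻¹ * z / v j)) *
          laxProd q c v l₁.reverse z) := fun v => by
    simp [laxProd, hl, mul_assoc]
  have ha : q⁻¹ * z / w j ≠ 0 := div_ne_zero (mul_ne_zero (inv_ne_zero hq) hz) (hw j)
  have he : q⁻¹ * z / w j' = q⁻¹ * z / w j * (w j / w j') := by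
    have := hw j
    field_simp
  have hloc := diagonal_mul_lax_mul_lax q c (w j / w j') _ hq
    (div_ne_zero (hw j) (hw j')) ha hc j h
  rw [← he, ← hj'] at hloc
  have key : Matrix.diagonal (fun _ : Fin 2 => twoSite (Rcheck q (w j / w j')) j h) *
      laxProd q c w (List.finRange N).reverse z = laxProd q c w' (List.finRange N).reverse z *
        Matrix.diagonal (fun _ : Fin 2 => twoSite (Rcheck q (w j / w j')) j h) := by
    have e₁ := diagonal_mul_laxProd q c w w' (Rcheck q (w j / w j')) h (l := l₁.reverse)
      (fun k hk => h₁ k (List.mem_reverse.1 hk))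
      (fun k hk => hswap k (h₁ k (List.mem_reverse.1 hk))) z
    have e₂ := diagonal_mul_laxProd q c w w' (Rcheck q (w j / w j')) h (l := l₂.reverse)
      (fun k hk => h₂ k (List.mem_reverse.1 hk))
      (fun k hk => hswap k (h₂ k (List.mem_reverse.1 hk))) z
    rw [hsplit, hsplit, hwj, hwj', ← mul_assoc, e₂, mul_assoc, ← mul_assoc (diagonal _), hloc,
      mul_assoc _ (diagonal _), e₁]
    simp only [mul_assoc]
  have := congrFun (congrFun key 0) 1
  rwa [Matrix.diagonal_mul, Matrix.mul_diagonal, ← Bop_eq_laxProd, ← Bop_eq_laxProd] at this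

theorem twoSite_Rcheck_vac (q x : ℂ) {N : ℕ} (j : Fin N) (h : (j : ℕ) + 1 < N) :
    twoSite (Rcheck q x) j h *ᵥ vac N = (br (q * x) * br (q^2 * x)) • vac N := by
  have hne : j ≠ ⟨(j : ℕ) + 1, h⟩ := fun e => by simpa using congrArg Fin.val e
  ext σ
  rw [Matrix.mulVec, dotProduct, Finset.sum_eq_single (fun _ => 0)
    (fun τ _ hτ => by simp [vac, hτ]) (by simp)]
  simp only [twoSite, Matrix.of_apply, vac, if_true, mul_one, Rcheck_apply, Pi.smul_apply,
    smul_eq_mul]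
  by_cases hσ : σ = fun _ => 0
  · subst hσ
    simp [R19]
  · rw [if_neg hσ, mul_zero]
    by_cases hr : ∀ k, k ≠ j → k ≠ ⟨(j : ℕ) + 1, h⟩ → σ k = 0
    · have hor : ¬ (σ j = 0 ∧ σ ⟨(j : ℕ) + 1, h⟩ = 0) := fun h0 => hσ <| by
        ext1 k
        by_cases hk : k = j
        · rw [hk, h0.1]
        · by_cases hk' : k = ⟨(j : ℕ) + 1, h⟩
          · rw [hk', h0.2]
          · exact hr k hk hk'
      generalize σ j = s at hor
      generalize σ ⟨(j : ℕ) + 1, h⟩ = t at hor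
      fin_cases s <;> fin_cases t <;> simp [R19] at hor ⊢
    · rw [if_neg hr, mul_zero]

/-- Exchange relation:
`Ř_{j,j+1}(w_j/w_{j+1}) |Ψ(…,w_j,w_{j+1},…)⟩ = [q w_j/w_{j+1}][q² w_j/w_{j+1}] |Ψ(…,w_{j+1},w_j,…)⟩`. -/
theorem stmt10 (q c : ℂ) (hq : q ≠ 0) (hc : c^2 = br q * br (q^2))
    (N : ℕ) (hN : 2 ≤ N) (w : Fin N → ℂ) (hw : ∀ j, w j ≠ 0)
    (j : Fin N) (h : (j : ℕ) + 1 < N) :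
    (twoSite (Rcheck q (w j / w ⟨(j : ℕ) + 1, h⟩)) j h).mulVec (bethe q c w) =
      (br (q * w j / w ⟨(j : ℕ) + 1, h⟩) * br (q^2 * w j / w ⟨(j : ℕ) + 1, h⟩)) •
        bethe q c (w ∘ Equiv.swap j ⟨(j : ℕ) + 1, h⟩) := by
  have hpull : ∀ l : List (Fin N),
      twoSite (Rcheck q (w j / w ⟨(j : ℕ) + 1, h⟩)) j h * (l.map fun k => Bop q c w (w k)).prod =
        (l.map fun k => Bop q c (w ∘ Equiv.swap j ⟨(j : ℕ) + 1, h⟩) (w k)).prod *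
          twoSite (Rcheck q (w j / w ⟨(j : ℕ) + 1, h⟩)) j h := fun l => by
    induction l with
    | nil => simp
    | cons i l ih =>
      rw [List.map_cons, List.prod_cons, ← mul_assoc, twoSite_mul_Bop q c hq hc w hw j h (hw i),
        mul_assoc, ih, List.map_cons, List.prod_cons, mul_assoc]
  rw [bethe, Matrix.mulVec_mulVec, hpull, ← Matrix.mulVec_mulVec, twoSite_Rcheck_vac,
    Matrix.mulVec_smul, bethe, ← mul_div_assoc, ← mul_div_assoc]
  by_cases h0 : br (q * w j / w ⟨(j : ℕ) + 1, h⟩) = 0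
  · rw [h0, zero_mul, zero_smul, zero_smul]
  congr 2
  obtain ⟨l₁, l₂, hl, h₁, h₂⟩ := finRange_eq_append j h
  set j' : Fin N := ⟨(j : ℕ) + 1, h⟩
  have hmap : ∀ l : List (Fin N), (∀ k ∈ l, k ≠ j ∧ k ≠ j') →
      (l.map fun k => Bop q c (w ∘ Equiv.swap j j') (w k)) =
        l.map fun k => Bop q c (w ∘ Equiv.swap j j') ((w ∘ Equiv.swap j j') k) := fun l hl =>
    List.map_congr_left fun k hk => by
      rw [Function.comp_apply, Equiv.swap_apply_of_ne_of_ne (hl k hk).1 (hl k hk).2]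
  have hcomm := Bop_commute q c hq hc (w ∘ Equiv.swap j j') (fun k => hw _) (hw j) (hw j')
    (by rwa [← mul_div_assoc])
  rw [hl, List.map_append, List.map_append, List.prod_append, List.prod_append, hmap l₁ h₁]
  simp only [List.map_cons, List.prod_cons]
  rw [hmap l₂ h₂, Function.comp_apply, Function.comp_apply, Equiv.swap_apply_left,
    Equiv.swap_apply_right, ← mul_assoc (Bop _ _ _ _), hcomm.eq, mul_assoc (Bop _ _ _ _)]

end
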